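/- arXiv:0809.2230 — 2 statements merged into one kernel-verified Lean document; each statement's English description precedes it below -/
import Mathlib

section
/- Let s ≤ t be reals, let ξ : [s,t] → ℝ be continuous, and let ψ : [s,t] → ℂ be a solution of the Loewner ODE driven by ξ with Im ψ(r) > 0 for all r ∈ [s,t]. Then e^s·sinh(Im ψ(s)/2)² ≥ e^t·sinh(Im ψ(t)/2)². -/
open Complex Topology Filter Set

noncomputable section

/-- `cot₂ z = cot(z/2)`. -/
def cot2 (z : ℂ) : ℂ := Complex.cot (z / 2)

/-- A solution of the Loewner ODE driven by `ξ` on the real interval `I`: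
a differentiable `ψ : I → ℂ` with `ψ'(t) = cot₂(ψ(t) − ξ(t))` for all `t ∈ I`
(in particular `ψ(t) − ξ(t) ∉ 2πℤ` for all `t ∈ I`). -/
def IsLoewnerSolOn (ξ : ℝ → ℝ) (I : Set ℝ) (ψ : ℝ → ℂ) : Prop :=
  ∀ t ∈ I, (∀ n : ℤ, ψ t - (ξ t : ℂ) ≠ 2 * (Real.pi : ℂ) * (n : ℂ)) ∧
    HasDerivWithinAt ψ (cot2 (ψ t - (ξ t : ℂ))) I t

theorem Complex.cot_im (w : ℂ) :
    (Complex.cot w).im =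
      -(Real.sinh w.im * Real.cosh w.im) / (Real.sin w.re ^ 2 + Real.sinh w.im ^ 2) := by
  have hre : (Complex.sin w).re = Real.sin w.re * Real.cosh w.im := by
    rw [Complex.sin_eq]
    simp [sin_ofReal_re, cos_ofReal_re, sinh_ofReal_re]
  have him : (Complex.sin w).im = Real.cos w.re * Real.sinh w.im := by
    rw [Complex.sin_eq]
    simp [sin_ofReal_re, cos_ofReal_re, sinh_ofReal_re]
  have hcos_re : (Complex.cos w).re = Real.cos w.re * Real.cosh w.im := by
    rw [Complex.cos_eq]
    simp [sin_ofReal_re, cos_ofReal_re, sinh_ofReal_re]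
  have hcos_im : (Complex.cos w).im = -(Real.sin w.re * Real.sinh w.im) := by
    rw [Complex.cos_eq]
    simp [sin_ofReal_re, cos_ofReal_re, sinh_ofReal_re]
  have hnorm : Complex.normSq (Complex.sin w) = Real.sin w.re ^ 2 + Real.sinh w.im ^ 2 := by
    rw [Complex.normSq_apply, hre, him]
    linear_combination Real.sin w.re ^ 2 * Real.cosh_sq w.im +
      Real.sinh w.im ^ 2 * Real.sin_sq_add_cos_sq w.re
  rw [Complex.cot, Complex.div_im, hnorm, hre, him, hcos_re, hcos_im, ← sub_div]
  congr 1
  linear_combination -(Real.sinh w.im * Real.cosh w.im) * Real.sin_sq_add_cos_sq w.re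

theorem Complex.sinh_im_add_cosh_im_mul_cot_im_nonpos {w : ℂ} (hw : 0 < w.im) :
    Real.sinh w.im + Real.cosh w.im * (Complex.cot w).im ≤ 0 := by
  have hs : 0 < Real.sinh w.im := Real.sinh_pos_iff.2 hw
  have hD : 0 < Real.sin w.re ^ 2 + Real.sinh w.im ^ 2 := by positivity
  have heq : Real.sinh w.im + Real.cosh w.im * (Complex.cot w).im =
      -(Real.sinh w.im * Real.cos w.re ^ 2) / (Real.sin w.re ^ 2 + Real.sinh w.im ^ 2) := by
    rw [Complex.cot_im, eq_div_iff hD.ne']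
    field_simp
    linear_combination Real.sin_sq_add_cos_sq w.re - Real.cosh_sq w.im
  rw [heq]
  exact div_nonpos_of_nonpos_of_nonneg (neg_nonpos.2 (by positivity)) hD.le

/-- If `ψ` solves the Loewner ODE driven by a continuous `ξ` on `[s,t]` with
`Im ψ > 0` throughout, then `e^s·sinh(Im ψ(s)/2)² ≥ e^t·sinh(Im ψ(t)/2)²`. -/
theorem loewner_sinh_decay (s t : ℝ) (hst : s ≤ t)
    (ξ : ℝ → ℝ) (hξ : ContinuousOn ξ (Set.Icc s t))
    (ψ : ℝ → ℂ) (hψ : IsLoewnerSolOn ξ (Set.Icc s t) ψ)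
    (him : ∀ r ∈ Set.Icc s t, 0 < (ψ r).im) :
    Real.exp t * Real.sinh ((ψ t).im / 2) ^ 2 ≤
      Real.exp s * Real.sinh ((ψ s).im / 2) ^ 2 := by
  have hderiv : ∀ r ∈ Set.Icc s t, HasDerivWithinAt
      (fun r => Real.exp r * Real.sinh ((ψ r).im / 2) ^ 2)
      (Real.exp r * Real.sinh ((ψ r).im / 2) * (Real.sinh ((ψ r).im / 2) +
        Real.cosh ((ψ r).im / 2) * (cot2 (ψ r - ξ r)).im)) (Set.Icc s t) r := by
    intro r hr
    have hy : HasDerivWithinAt (fun r => (ψ r).im) (cot2 (ψ r - ξ r)).im (Set.Icc s t) r :=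
      Complex.imCLM.hasFDerivAt.comp_hasDerivWithinAt r (hψ r hr).2
    refine ((Real.hasDerivAt_exp r).hasDerivWithinAt.mul
      ((hy.div_const 2).sinh.pow 2)).congr_deriv ?_
    simp only [Pi.pow_apply]
    push_cast
    ring
  refine antitoneOn_of_hasDerivWithinAt_nonpos (convex_Icc s t)
    (fun r hr => (hderiv r hr).continuousWithinAt)
    (fun r hr => (hderiv r (interior_subset hr)).mono interior_subset) ?_
    (Set.left_mem_Icc.2 hst) (Set.right_mem_Icc.2 hst) hst
  intro r hr
  have hpos := him r (interior_subset hr)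
  have hw : ((ψ r - ξ r) / 2).im = (ψ r).im / 2 := by simp
  have hle := Complex.sinh_im_add_cosh_im_mul_cot_im_nonpos (w := (ψ r - ξ r) / 2)
    (by rw [hw]; positivity)
  rw [hw] at hle
  exact mul_nonpos_of_nonneg_of_nonpos
    (mul_nonneg (Real.exp_pos r).le (Real.sinh_nonneg_iff.2 (by positivity))) hle
end
end

section
/- Let 0 < h₀ < h, and let J be a harmonic function on {z ∈ ℂ : |Im z| < h} satisfying J(conj(z)) = −J(z) for all z, J > 0 on S_h, and J(z + 2π) = J(z) for all z. Set m = inf{J(x + i·h₀) : x ∈ ℝ} and M = sup{J(x + i·h₀) : x ∈ ℝ}. Then for every x ∈ ℝ: ∂_y J(x) ≥ m/h₀, |∂_x∂_y J(x)| ≤ 4M/h₀², and |∂_x²∂_y J(x)| ≤ 12M/h₀³. -/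
open Complex Topology Filter Set

noncomputable section

/-- Partial derivative in the real (horizontal) direction. -/
def pdx (J : ℂ → ℝ) (z : ℂ) : ℝ := deriv (fun x : ℝ => J (z + (x : ℂ))) 0

/-- Partial derivative in the imaginary (vertical) direction. -/
def pdy (J : ℂ → ℝ) (z : ℂ) : ℝ := deriv (fun y : ℝ => J (z + (y : ℂ) * Complex.I)) 0

/-- A real-valued function is harmonic on an open set if it is C² there with
vanishing Laplacian. -/
def IsHarmonicOn (J : ℂ → ℝ) (U : Set ℂ) : Prop :=
  ContDiffOn ℝ 2 J U ∧ ∀ z ∈ U, pdx (pdx J) z + pdy (pdy J) z = 0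

theorem deriv_deriv_nonpos_of_isLocalMax {f : ℝ → ℝ} {a : ℝ} (hmax : IsLocalMax f a)
    (hc : ContinuousAt f a) : deriv (deriv f) a ≤ 0 := by
  by_contra! hpos
  have hmin : IsLocalMin f a := isLocalMin_of_deriv_deriv_pos hpos hmax.deriv_eq_zero hc
  have hconst : f =ᶠ[𝓝 a] fun _ => f a := by
    filter_upwards [hmax, hmin] with x h₁ h₂ using le_antisymm h₁ h₂
  have : deriv (deriv f) a = 0 := by
    rw [hconst.deriv.deriv_eq]; simp
  exact hpos.ne' this

theorem pdx_add_ofReal (J : ℂ → ℝ) (z : ℂ) (t : ℝ) :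
    pdx J (z + t) = deriv (fun x : ℝ => J (z + x)) t := by
  have := deriv_comp_const_add (f := fun x : ℝ => J (z + x)) t 0
  simpa [pdx, add_assoc] using this

theorem pdy_add_ofReal_mul_I (J : ℂ → ℝ) (z : ℂ) (t : ℝ) :
    pdy J (z + t * I) = deriv (fun y : ℝ => J (z + y * I)) t := by
  have := deriv_comp_const_add (f := fun y : ℝ => J (z + y * I)) t 0
  simpa [pdy, add_assoc, add_mul] using this

theorem pdx_pdx_eq (J : ℂ → ℝ) (z : ℂ) :
    pdx (pdx J) z = deriv (deriv fun x : ℝ => J (z + x)) 0 := by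
  rw [pdx]; simp_rw [pdx_add_ofReal]

theorem pdy_pdy_eq (J : ℂ → ℝ) (z : ℂ) :
    pdy (pdy J) z = deriv (deriv fun y : ℝ => J (z + y * I)) 0 := by
  rw [pdy]; simp_rw [pdy_add_ofReal_mul_I]

theorem pdx_eq_fderiv {J : ℂ → ℝ} {z : ℂ} (hJ : DifferentiableAt ℝ J z) :
    pdx J z = fderiv ℝ J z 1 := by
  have := hJ.lineDeriv_eq_fderiv (v := 1)
  simpa [lineDeriv, pdx] using this

theorem pdy_eq_fderiv {J : ℂ → ℝ} {z : ℂ} (hJ : DifferentiableAt ℝ J z) :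
    pdy J z = fderiv ℝ J z I := by
  have := hJ.lineDeriv_eq_fderiv (v := I)
  simpa [lineDeriv, pdy] using this

theorem Filter.EventuallyEq.pdx_eq {J K : ℂ → ℝ} {z : ℂ} (h : J =ᶠ[𝓝 z] K) :
    pdx J z = pdx K z := by
  have ht : Tendsto (fun x : ℝ => z + (x : ℂ)) (𝓝 0) (𝓝 z) :=
    Continuous.tendsto' (by fun_prop) _ _ (by simp)
  exact Filter.EventuallyEq.deriv_eq (ht.eventually h)

theorem Filter.EventuallyEq.pdy_eq {J K : ℂ → ℝ} {z : ℂ} (h : J =ᶠ[𝓝 z] K) :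
    pdy J z = pdy K z := by
  have ht : Tendsto (fun y : ℝ => z + (y : ℂ) * I) (𝓝 0) (𝓝 z) :=
    Continuous.tendsto' (by fun_prop) _ _ (by simp)
  exact Filter.EventuallyEq.deriv_eq (ht.eventually h)

theorem IsHarmonicOn.contDiffAt {J : ℂ → ℝ} {U : Set ℂ} (hJ : IsHarmonicOn J U) (hU : IsOpen U)
    {z : ℂ} (hz : z ∈ U) : ContDiffAt ℝ 2 J z :=
  hJ.1.contDiffAt (hU.mem_nhds hz)

theorem IsHarmonicOn.harmonicOnNhd {J : ℂ → ℝ} {U : Set ℂ} (hJ : IsHarmonicOn J U)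
    (hU : IsOpen U) : InnerProductSpace.HarmonicOnNhd J U := by
  intro z hz
  refine ⟨hJ.contDiffAt hU hz, ?_⟩
  filter_upwards [hU.mem_nhds hz] with w hw
  have hdiff : ∀ᶠ u in 𝓝 w, DifferentiableAt ℝ J u := by
    filter_upwards [hU.mem_nhds hw] with u hu
    exact (hJ.contDiffAt hU hu).differentiableAt (by simp)
  have hfd : DifferentiableAt ℝ (fderiv ℝ J) w :=
    ((hJ.contDiffAt hU hw).fderiv_right (m := 1) (by norm_num)).differentiableAt (by simp)
  have hx : pdx (pdx J) w = fderiv ℝ (fderiv ℝ J) w 1 1 := by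
    have : pdx J =ᶠ[𝓝 w] fun u => fderiv ℝ J u 1 := by
      filter_upwards [hdiff] with u hu using pdx_eq_fderiv hu
    rw [this.pdx_eq, pdx_eq_fderiv (hfd.clm_apply (differentiableAt_const _)),
      fderiv_clm_apply hfd (differentiableAt_const _)]
    simp
  have hy : pdy (pdy J) w = fderiv ℝ (fderiv ℝ J) w I I := by
    have : pdy J =ᶠ[𝓝 w] fun u => fderiv ℝ J u I := by
      filter_upwards [hdiff] with u hu using pdy_eq_fderiv hu
    rw [this.pdy_eq, pdy_eq_fderiv (hfd.clm_apply (differentiableAt_const _)),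
      fderiv_clm_apply hfd (differentiableAt_const _)]
    simp
  have := hJ.2 w hw
  rw [hx, hy] at this
  rw [InnerProductSpace.laplacian_eq_iteratedFDeriv_complexPlane]
  simpa [iteratedFDeriv_two_apply] using this

theorem eqOn_pdx_of_eqOn_re {J : ℂ → ℝ} {F : ℂ → ℂ} {U : Set ℂ} (hU : IsOpen U)
    (hF : DifferentiableOn ℂ F U) (hJ : EqOn J (fun z => (F z).re) U) :
    EqOn (pdx J) (fun z => (deriv F z).re) U := by
  intro z hz
  have hd : HasDerivAt F (deriv F z) z := (hF.differentiableAt (hU.mem_nhds hz)).hasDerivAt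
  have hre := (reCLM.hasFDerivAt.comp z (hd.hasFDerivAt.restrictScalars ℝ))
  have heq : J =ᶠ[𝓝 z] reCLM ∘ F := by
    filter_upwards [hU.mem_nhds hz] with w hw using hJ hw
  rw [heq.pdx_eq, pdx_eq_fderiv hre.differentiableAt, hre.fderiv]
  simp

theorem eqOn_pdy_of_eqOn_re {J : ℂ → ℝ} {F : ℂ → ℂ} {U : Set ℂ} (hU : IsOpen U)
    (hF : DifferentiableOn ℂ F U) (hJ : EqOn J (fun z => (F z).re) U) :
    EqOn (pdy J) (fun z => (I * deriv F z).re) U := by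
  intro z hz
  have hd : HasDerivAt F (deriv F z) z := (hF.differentiableAt (hU.mem_nhds hz)).hasDerivAt
  have hre := (reCLM.hasFDerivAt.comp z (hd.hasFDerivAt.restrictScalars ℝ))
  have heq : J =ᶠ[𝓝 z] reCLM ∘ F := by
    filter_upwards [hU.mem_nhds hz] with w hw using hJ hw
  rw [heq.pdy_eq, pdy_eq_fderiv hre.differentiableAt, hre.fderiv]
  simp

open Metric in
/-- Cauchy's estimate for derivatives in terms of the real part. -/
theorem norm_iteratedDeriv_le_of_abs_re_le {F : ℂ → ℂ} {c : ℂ} {R C : ℝ} {n : ℕ} (hR : 0 < R)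
    (hn : n ≠ 0) (hF : DiffContOnCl ℂ F (ball c R))
    (hC : ∀ z ∈ sphere c R, |(F z).re| ≤ C) :
    ‖iteratedDeriv n F c‖ ≤ n.factorial * (2 * C) / R ^ n := by
  have hcont : ContinuousOn F (sphere c R) := hF.continuousOn_ball.mono sphere_subset_closedBall
  have hne : ∀ z ∈ sphere c R, z - c ≠ 0 := fun z hz h => by
    rw [mem_sphere_iff_norm, h, norm_zero] at hz
    exact hR.ne hz
  have hpow : ContinuousOn (fun z : ℂ => (z - c)⁻¹ ^ (n + 1)) (sphere c R) :=
    (ContinuousOn.inv₀ (by fun_prop) hne).pow _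
  have hRC : (R : ℂ) ≠ 0 := by exact_mod_cast hR.ne'
  have hcoeff : iteratedDeriv n F c = n.factorial • (2 * Real.pi * I)⁻¹ •
      ∮ z in C(c, R), (z - c)⁻¹ ^ (n + 1) • F z := by
    have h₀ : (2 * Real.pi * I / n.factorial : ℂ) ≠ 0 := by simp [Nat.factorial_ne_zero]
    rw [← inv_smul_smul₀ h₀ (iteratedDeriv n F c), inv_div, div_eq_inv_mul, mul_comm,
      ← nsmul_eq_mul, smul_assoc]
    rw [← DiffContOnCl.circleIntegral_one_div_sub_center_pow_smul hR n hF]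
    simp only [one_div, inv_pow]
  have hconj : ∮ z in C(c, R), (z - c)⁻¹ ^ (n + 1) • (starRingEnd ℂ) (F z) = 0 := by
    have hG : DiffContOnCl ℂ (fun z => (z - c) ^ n • F z) (ball c R) :=
      DiffContOnCl.smul (Differentiable.diffContOnCl (by fun_prop)) hF
    have hmean : Real.circleAverage (fun z => (z - c) ^ n • F z) c R = 0 := by
      rw [DiffContOnCl.circleAverage (by rwa [abs_of_pos hR])]
      simp [hn]
    have hint : CircleIntegrable (fun z => (z - c) ^ n • F z) c R :=
      (hG.continuousOn_ball.mono sphere_subset_closedBall).circleIntegrable hR.le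
    have hstar := conjCLE.toContinuousLinearMap.circleAverage_comp_comm hint
    rw [hmean, map_zero, Real.circleAverage_eq_circleIntegral hR.ne', smul_eq_zero] at hstar
    have hstar := hstar.resolve_left (by simp [Real.pi_ne_zero])
    have hscale : (R : ℂ) ^ (2 * n) *
        (∮ z in C(c, R), (z - c)⁻¹ ^ (n + 1) • (starRingEnd ℂ) (F z)) = 0 := by
      rw [← hstar, ← smul_eq_mul, ← circleIntegral.integral_smul]
      refine circleIntegral.integral_congr hR.le fun z hz => ?_
      have hz₀ := hne z hz
      have hmul : (z - c) * (starRingEnd ℂ) (z - c) = (R : ℂ) ^ 2 := by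
        rw [mul_conj, normSq_eq_norm_sq, mem_sphere_iff_norm.1 hz]; push_cast; ring
      have hcj : (starRingEnd ℂ) (z - c) = (R : ℂ) ^ 2 * (z - c)⁻¹ := by
        rw [← hmul]; field_simp
      simp only [smul_eq_mul, Function.comp, ContinuousLinearEquiv.coe_coe, conjCLE_apply,
        map_mul, map_pow, hcj]
      ring
    exact (mul_eq_zero.1 hscale).resolve_left (pow_ne_zero _ hRC)
  have hsum : ∮ z in C(c, R), (z - c)⁻¹ ^ (n + 1) • F z =
      ∮ z in C(c, R), (z - c)⁻¹ ^ (n + 1) • ((2 * (F z).re : ℝ) : ℂ) := by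
    rw [← add_zero (∮ z in C(c, R), (z - c)⁻¹ ^ (n + 1) • F z), ← hconj,
      ← circleIntegral.integral_add]
    · refine circleIntegral.integral_congr hR.le fun z _ => ?_
      simp only [← smul_add, add_conj]
    · exact (hpow.smul hcont).circleIntegrable hR.le
    · exact (hpow.smul (continuous_conj.comp_continuousOn hcont)).circleIntegrable hR.le
  have hbound : ∀ z ∈ sphere c R,
      ‖(z - c)⁻¹ ^ (n + 1) • ((2 * (F z).re : ℝ) : ℂ)‖ ≤ 2 * C / R ^ (n + 1) := by
    intro z hz
    rw [norm_smul, norm_pow, norm_inv, mem_sphere_iff_norm.1 hz, norm_real, Real.norm_eq_abs,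
      abs_mul, abs_two, inv_pow, ← div_eq_inv_mul]
    gcongr
    exact hC z hz
  rw [hcoeff, hsum, RCLike.norm_nsmul (K := ℂ), nsmul_eq_mul, mul_div_assoc]
  gcongr
  refine (circleIntegral.norm_two_pi_i_inv_smul_integral_le_of_norm_le_const hR.le hbound).trans_eq
    ?_
  field_simp
  ring

/-- The maximum principle on a strip for a horizontally periodic harmonic function plus a multiple
of the height. -/
theorem IsHarmonicOn.mul_add_mul_im_le {J : ℂ → ℝ} {U : Set ℂ} {p h₀ a b C : ℝ}
    (hJ : IsHarmonicOn J U) (hU : IsOpen U) (hp : 0 < p)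
    (hsub : ∀ z : ℂ, 0 ≤ z.im → z.im ≤ h₀ → z ∈ U)
    (hper : ∀ z : ℂ, 0 ≤ z.im → z.im ≤ h₀ → J (z + p) = J z)
    (hbot : ∀ z : ℂ, z.im = 0 → a * J z ≤ C)
    (htop : ∀ z : ℂ, z.im = h₀ → a * J z + b * h₀ ≤ C)
    {z : ℂ} (hz₀ : 0 ≤ z.im) (hz₁ : z.im ≤ h₀) : a * J z + b * z.im ≤ C := by
  have key : ∀ ε > 0, a * J z + b * z.im ≤ C + ε * h₀ ^ 2 := by
    intro ε hε
    let v : ℂ → ℝ := fun w => a * J w + b * w.im + ε * w.im ^ 2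
    have hcont : ∀ w ∈ U, ContinuousAt v w := fun w hw => by
      have := (hJ.contDiffAt hU hw).continuousAt
      fun_prop
    let K : Set ℂ := Icc 0 p ×ℂ Icc 0 h₀
    have hK : IsCompact K := isCompact_Icc.reProdIm isCompact_Icc
    have hshift : ∀ w : ℂ, 0 ≤ w.im → w.im ≤ h₀ → ∃ w' ∈ K, v w' = v w := by
      intro w hw₀ hw₁
      have hg : Function.Periodic (fun x : ℝ => v (x + w.im * I)) p := by
        intro x
        have := hper (x + w.im * I) (by simpa using hw₀) (by simpa using hw₁)
        simp only [v, ofReal_add]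
        rw [add_right_comm (x : ℂ), this]
        simp
      obtain ⟨x, hx, hxe⟩ := hg.exists_mem_Ico₀ hp w.re
      refine ⟨x + w.im * I, ?_, ?_⟩
      · simp [K, mem_reProdIm, hx.1, hx.2.le, hw₀, hw₁]
      · simpa [re_add_im] using hxe.symm
    obtain ⟨z', hz'K, -⟩ := hshift z hz₀ hz₁
    obtain ⟨w, hwK, hw⟩ := hK.exists_isMaxOn ⟨z', hz'K⟩ (f := v) fun u hu =>
      (hcont u (hsub u hu.2.1 hu.2.2)).continuousWithinAt
    have hmax : ∀ u : ℂ, 0 ≤ u.im → u.im ≤ h₀ → v u ≤ v w := by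
      intro u hu₀ hu₁
      obtain ⟨u', hu', he⟩ := hshift u hu₀ hu₁
      exact he ▸ hw hu'
    have hw₀ : 0 ≤ w.im := hwK.2.1
    have hw₁ : w.im ≤ h₀ := hwK.2.2
    have hvw : v w ≤ C + ε * h₀ ^ 2 := by
      rcases hw₀.eq_or_lt with h0 | h0
      · have := hbot w h0.symm
        have : 0 ≤ ε * h₀ ^ 2 := by positivity
        simp only [v, ← h0]
        linarith
      rcases hw₁.eq_or_lt with h1 | h1
      · have := htop w h1
        simp only [v, h1]
        linarith
      exfalso
      have hwU := hsub w hw₀ hw₁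
      have hloc : IsLocalMax v w := by
        have : {u : ℂ | 0 < u.im ∧ u.im < h₀} ∈ 𝓝 w :=
          ((isOpen_lt continuous_const continuous_im).inter
            (isOpen_lt continuous_im continuous_const)).mem_nhds ⟨h0, h1⟩
        filter_upwards [this] with u hu using hmax u hu.1.le hu.2.le
      have hline : ∀ d : ℂ, ContinuousAt (fun t : ℝ => w + t * d) 0 := fun d => by fun_prop
      have hdir : ∀ d : ℂ, deriv (deriv fun t : ℝ => v (w + t * d)) 0 ≤ 0 := by
        intro d
        have hw' : w + ((0 : ℝ) : ℂ) * d = w := by simp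
        refine deriv_deriv_nonpos_of_isLocalMax ?_ ?_
        · have : Tendsto (fun t : ℝ => w + t * d) (𝓝 0) (𝓝 w) := by
            simpa [ContinuousAt] using hline d
          simpa [IsLocalMax, IsMaxFilter] using this.eventually hloc
        · refine ContinuousAt.comp (g := v) ?_ (hline d)
          rw [hw']
          exact hcont w hwU
      have hx : deriv (deriv fun t : ℝ => v (w + t * 1)) 0 = a * pdx (pdx J) w := by
        have : (fun t : ℝ => v (w + t * 1)) =
            fun t : ℝ => a * J (w + t) + (b * w.im + ε * w.im ^ 2) := by
          ext t; simp [v, add_assoc]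
        rw [this, pdx_pdx_eq]
        simp only [deriv_add_const', deriv_const_mul_field']
      have hy : deriv (deriv fun t : ℝ => v (w + t * I)) 0 = a * pdy (pdy J) w + 2 * ε := by
        let g : ℝ → ℝ := fun t => J (w + t * I)
        have hg : ContDiffAt ℝ 2 g 0 := by
          refine ContDiffAt.comp (g := J) 0 ?_ ?_
          · simpa using hJ.contDiffAt hU hwU
          · exact contDiffAt_const.add (ofRealCLM.contDiff.contDiffAt.mul contDiffAt_const)
        have hg' : ∀ᶠ t in 𝓝 (0 : ℝ), DifferentiableAt ℝ g t :=
          (hg.eventually (by simp)).mono fun t ht => ht.differentiableAt (by simp)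
        have hg'' : DifferentiableAt ℝ (deriv g) 0 :=
          (hg.derivWithin (m := 1) (by norm_num)).differentiableAt (by simp)
        have hd : (deriv fun t : ℝ => v (w + t * I)) =ᶠ[𝓝 0]
            fun t => a * deriv g t + (b + 2 * ε * (w.im + t)) := by
          filter_upwards [hg'] with t ht
          have hlin : HasDerivAt (fun t : ℝ => w.im + t) 1 t := (hasDerivAt_id t).const_add _
          have := ((ht.hasDerivAt.const_mul a).add (hlin.const_mul b)).add
            ((hlin.pow 2).const_mul ε)
          have he : (fun t : ℝ => v (w + t * I)) =
              fun t => a * g t + b * (w.im + t) + ε * (w.im + t) ^ 2 := by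
            ext t; simp [v, g]
          rw [he]
          refine (HasDerivAt.deriv this).trans ?_
          simp; ring
        have hlin : HasDerivAt (fun t : ℝ => w.im + t) 1 0 := (hasDerivAt_id 0).const_add _
        rw [hd.deriv_eq, pdy_pdy_eq]
        refine (HasDerivAt.deriv ((hg''.hasDerivAt.const_mul a).add
          ((hlin.const_mul (2 * ε)).const_add b))).trans ?_
        simp [g]
      have h₁ := hdir 1
      have h₂ := hdir I
      rw [hx] at h₁
      rw [hy] at h₂
      have h₃ : a * (pdx (pdx J) w + pdy (pdy J) w) = 0 := by rw [hJ.2 w hwU, mul_zero]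
      linarith
    have hvz := (hmax z hz₀ hz₁).trans hvw
    have : 0 ≤ ε * z.im ^ 2 := by positivity
    simp only [v] at hvz
    linarith
  have hlim : Tendsto (fun ε : ℝ => C + ε * h₀ ^ 2) (𝓝[>] 0) (𝓝 C) :=
    (Continuous.tendsto' (by fun_prop) _ _ (by simp)).mono_left nhdsWithin_le_nhds
  exact ge_of_tendsto hlim (eventually_nhdsWithin_of_forall key)

/-- Let `0 < h₀ < h` and let `J` be harmonic on `{|Im z| < h}`, odd under
conjugation, positive on the strip `0 < Im z < h`, and `2π`-periodic. With
`m = inf {J(x + i h₀) : x ∈ ℝ}` and `M = sup {J(x + i h₀) : x ∈ ℝ}`, for every real `x`: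
`∂_y J(x) ≥ m/h₀`, `|∂_x∂_y J(x)| ≤ 4M/h₀²`, and `|∂_x²∂_y J(x)| ≤ 12M/h₀³`. -/
theorem harmonic_derivative_harnack_bounds (h h₀ : ℝ) (hh₀ : 0 < h₀) (hlt : h₀ < h)
    (J : ℂ → ℝ) (hJ : IsHarmonicOn J {z : ℂ | |z.im| < h})
    (hodd : ∀ z : ℂ, |z.im| < h → J ((starRingEnd ℂ) z) = -J z)
    (hpos : ∀ z : ℂ, 0 < z.im → z.im < h → 0 < J z)
    (hper : ∀ z : ℂ, |z.im| < h → J (z + 2 * Real.pi) = J z)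
    (m M : ℝ)
    (hm : m = sInf (Set.range fun x : ℝ => J ((x : ℂ) + h₀ * Complex.I)))
    (hM : M = sSup (Set.range fun x : ℝ => J ((x : ℂ) + h₀ * Complex.I))) :
    ∀ x : ℝ,
      m / h₀ ≤ pdy J (x : ℂ) ∧
      |pdx (pdy J) (x : ℂ)| ≤ 4 * M / h₀ ^ 2 ∧
      |pdx (pdx (pdy J)) (x : ℂ)| ≤ 12 * M / h₀ ^ 3 := by
  have hU : IsOpen {z : ℂ | |z.im| < h} :=
    isOpen_lt (continuous_abs.comp continuous_im) continuous_const
  have hsub : ∀ z : ℂ, 0 ≤ z.im → z.im ≤ h₀ → z ∈ {z : ℂ | |z.im| < h} := fun z h1 h2 => by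
    simpa [abs_of_nonneg h1] using h2.trans_lt hlt
  have hper' : ∀ z : ℂ, 0 ≤ z.im → z.im ≤ h₀ → J (z + (2 * Real.pi : ℝ)) = J z :=
    fun z h1 h2 => by simpa using hper z (hsub z h1 h2)
  have hreal : ∀ z : ℂ, z.im = 0 → J z = 0 := fun z hz => by
    have := hodd z (by simpa [hz] using hh₀.trans hlt)
    rw [conj_eq_iff_im.2 hz] at this
    linarith
  have hline : ∀ z : ℂ, z.im = h₀ → J z = J ((z.re : ℂ) + h₀ * I) := fun z hz => by
    rw [← hz, re_add_im]
  have hbelow : BddBelow (range fun x : ℝ => J ((x : ℂ) + h₀ * I)) :=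
    ⟨0, by rintro _ ⟨x, rfl⟩; exact (hpos _ (by simpa) (by simpa)).le⟩
  have habove : BddAbove (range fun x : ℝ => J ((x : ℂ) + h₀ * I)) := by
    refine (Function.Periodic.compact_of_continuous (c := 2 * Real.pi) (fun x => ?_)
      Real.two_pi_pos.ne' ?_).bddAbove
    · have := hper' (x + h₀ * I) (by simpa using hh₀.le) (by simp)
      rw [← this, ofReal_add]
      congr 1
      ring
    · refine continuous_iff_continuousAt.2 fun x => ContinuousAt.comp (g := J) ?_ (by fun_prop)
      exact (hJ.contDiffAt hU (hsub _ (by simpa using hh₀.le) (by simp))).continuousAt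
  have hmle : ∀ z : ℂ, z.im = h₀ → m ≤ J z := fun z hz => by
    rw [hm, hline z hz]; exact csInf_le hbelow ⟨_, rfl⟩
  have hleM : ∀ z : ℂ, z.im = h₀ → J z ≤ M := fun z hz => by
    rw [hM, hline z hz]; exact le_csSup habove ⟨_, rfl⟩
  have hM₀ : 0 ≤ M := (hpos (h₀ * I) (by simpa) (by simpa)).le.trans (hleM _ (by simp))
  have hlow : ∀ z : ℂ, 0 ≤ z.im → z.im ≤ h₀ → m / h₀ * z.im ≤ J z := fun z h1 h2 => by
    have := hJ.mul_add_mul_im_le (a := -1) (b := m / h₀) (C := 0) hU Real.two_pi_pos hsub hper'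
      (fun z hz => by simp [hreal z hz])
      (fun z hz => by have := hmle z hz; rw [div_mul_cancel₀ _ hh₀.ne']; linarith) h1 h2
    linarith
  have hup : ∀ z : ℂ, 0 ≤ z.im → z.im ≤ h₀ → J z ≤ M := fun z h1 h2 => by
    have := hJ.mul_add_mul_im_le (a := 1) (b := 0) (C := M) hU Real.two_pi_pos hsub hper'
      (fun z hz => by simpa [hreal z hz] using hM₀)
      (fun z hz => by simpa using hleM z hz) h1 h2
    linarith
  have hnonneg : ∀ z : ℂ, 0 ≤ z.im → z.im ≤ h₀ → 0 ≤ J z := fun z h1 h2 => by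
    rcases h1.eq_or_lt with h0 | h0
    · exact (hreal z h0.symm).ge
    · exact (hpos z h0 (h2.trans_lt hlt)).le
  have habs : ∀ z : ℂ, |z.im| ≤ h₀ → |J z| ≤ M := fun z hz => by
    rcases le_total 0 z.im with h0 | h0
    · rw [abs_of_nonneg h0] at hz
      rw [abs_of_nonneg (hnonneg z h0 hz)]
      exact hup z h0 hz
    · have h1 : 0 ≤ ((starRingEnd ℂ) z).im := by simpa using h0
      have h2 : ((starRingEnd ℂ) z).im ≤ h₀ := by simpa [abs_of_nonpos h0] using hz
      rw [← abs_neg, ← hodd z (hz.trans_lt hlt), abs_of_nonneg (hnonneg _ h1 h2)]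
      exact hup _ h1 h2
  intro x
  have hball : Metric.ball (x : ℂ) h ⊆ {z : ℂ | |z.im| < h} := fun z hz => by
    rw [Metric.mem_ball, dist_eq_norm] at hz
    simpa using (abs_im_le_norm (z - x)).trans_lt hz
  constructor
  · have hd : HasDerivAt (fun y : ℝ => J (x + y * I)) (pdy J x) 0 := by
      refine DifferentiableAt.hasDerivAt ?_
      refine DifferentiableAt.comp (g := J) 0 ?_ ?_
      · refine (hJ.contDiffAt hU ?_).differentiableAt (by simp)
        simpa using hh₀.trans hlt
      · exact (ofRealCLM.differentiableAt.mul_const I).const_add _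
    refine ge_of_tendsto (hd.tendsto_slope.mono_left (nhdsGT_le_nhdsNE 0)) ?_
    filter_upwards [Ioo_mem_nhdsGT hh₀] with y hy
    have h1 := hlow (x + y * I) (by simpa using hy.1.le) (by simpa using hy.2.le)
    rw [slope_def_field, le_div_iff₀ (by simpa using hy.1), hreal (x + ((0 : ℝ) : ℂ) * I) (by simp)]
    simpa using h1
  obtain ⟨F, hFan, hFJ⟩ :=
    ((hJ.harmonicOnNhd hU).mono hball).exists_analyticOnNhd_ball_re_eq
  have hB : IsOpen (Metric.ball (x : ℂ) h) := Metric.isOpen_ball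
  have hxB : (x : ℂ) ∈ Metric.ball (x : ℂ) h := Metric.mem_ball_self (hh₀.trans hlt)
  have hcl : Metric.closedBall (x : ℂ) h₀ ⊆ Metric.ball (x : ℂ) h :=
    Metric.closedBall_subset_ball hlt
  have hdF := hFan.deriv
  have hddF := hdF.deriv
  have e1 := eqOn_pdy_of_eqOn_re hB hFan.differentiableOn hFJ.symm
  have e2 := eqOn_pdx_of_eqOn_re hB (hdF.differentiableOn.const_mul I) e1
  simp only [deriv_const_mul_field'] at e2
  have e3 := eqOn_pdx_of_eqOn_re hB (hddF.differentiableOn.const_mul I) e2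
  simp only [deriv_const_mul_field'] at e3
  have hC : ∀ z ∈ Metric.sphere (x : ℂ) h₀, |(F z).re| ≤ M := fun z hz => by
    have hzc := Metric.sphere_subset_closedBall hz
    rw [show (F z).re = J z from hFJ (hcl hzc)]
    rw [mem_sphere_iff_norm] at hz
    exact habs z (by simpa [hz] using abs_im_le_norm (z - x))
  have hDC : DiffContOnCl ℂ F (Metric.ball (x : ℂ) h₀) :=
    DifferentiableOn.diffContOnCl_ball hFan.differentiableOn hcl
  have b2 := norm_iteratedDeriv_le_of_abs_re_le (n := 2) hh₀ (by norm_num) hDC hC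
  have b3 := norm_iteratedDeriv_le_of_abs_re_le (n := 3) hh₀ (by norm_num) hDC hC
  simp only [iteratedDeriv_succ, iteratedDeriv_zero] at b2 b3
  constructor
  · rw [e2 hxB]
    refine (abs_re_le_norm _).trans ?_
    rw [norm_mul, norm_I, one_mul]
    refine b2.trans_eq ?_
    norm_num [Nat.factorial]; ring
  · rw [e3 hxB]
    refine (abs_re_le_norm _).trans ?_
    rw [norm_mul, norm_I, one_mul]
    refine b3.trans_eq ?_
    norm_num [Nat.factorial]; ring
end
end
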